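/- Let H be a limit sparse numerical semigroup with odd Frobenius number ℓ_g = 2g - (2r + 1) = 6r + 1 (so g = 4r + 1). If the multiplicity of H (its smallest positive element) is even, then every element of H smaller than ℓ_g is even; consequently H is r-hyperelliptic (H has exactly r even gaps). -/

import Mathlib

/-- `H` is a numerical semigroup of genus `g`: it contains `0`, is closed under
addition, and its complement in `ℕ` (the set of gaps) is finite with exactly
`g` elements. -/
def IsNumericalSemigroupOfGenus (H : Set ℕ) (g : ℕ) : Prop :=
  0 ∈ H ∧ (∀ a ∈ H, ∀ b ∈ H, a + b ∈ H) ∧ Hᶜ.Finite ∧ Hᶜ.ncard = g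

/-- The `i`-th gap `ℓ_i` of `H` (1-indexed): the `i`-th smallest element of `ℕ \ H`.
In particular, if `H` has genus `g`, then `gap H g` is the Frobenius number of `H`. -/
noncomputable def gap (H : Set ℕ) (i : ℕ) : ℕ :=
  Nat.nth (fun n => n ∉ H) (i - 1)

/-- A numerical semigroup `H` of genus `g` is sparse if any two subsequent gaps
differ by at most `2`. -/
def IsSparse (H : Set ℕ) (g : ℕ) : Prop :=
  ∀ i, 1 ≤ i → i ≤ g - 1 → gap H (i + 1) - gap H i ≤ 2

/-- `D`, the number of double leaps of `H` (of genus `g`). -/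
noncomputable def numDouble (H : Set ℕ) (g : ℕ) : ℕ :=
  {i : ℕ | 1 ≤ i ∧ i ≤ g - 1 ∧ gap H (i + 1) - gap H i = 2}.ncard

/-- `S`, the number of single leaps of `H` (of genus `g`). -/
noncomputable def numSingle (H : Set ℕ) (g : ℕ) : ℕ :=
  {i : ℕ | 1 ≤ i ∧ i ≤ g - 1 ∧ gap H (i + 1) - gap H i = 1}.ncard

/-- The multOf of `H`: its smallest positive element. -/
noncomputable def multOf (H : Set ℕ) : ℕ :=
  sInf {n : ℕ | n ∈ H ∧ 0 < n}

/-- The number of elements of `H` below a gap `F` equals that of the `x < F` with `x + 1 ∈ H`,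
plus one for `0`. -/
lemma card_filter_range_eq_card_succ_add_one (H : Set ℕ) [DecidablePred (· ∈ H)] {F : ℕ}
    (h0 : 0 ∈ H) (hF : F ∉ H) :
    ((Finset.range F).filter (· ∈ H)).card =
      ((Finset.range F).filter (fun x => x + 1 ∈ H)).card + 1 := by
  have hA : (Finset.range F).filter (· ∈ H) =
      insert 0 (((Finset.range F).filter (fun x => x + 1 ∈ H)).image Nat.succ) := by
    ext x
    simp only [Finset.mem_filter, Finset.mem_range, Finset.mem_insert, Finset.mem_image]
    constructor
    · rintro ⟨hx, hxH⟩
      rcases x with _ | x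
      · exact Or.inl rfl
      · exact Or.inr ⟨x, ⟨by omega, hxH⟩, rfl⟩
    · rintro (rfl | ⟨y, ⟨hy, hyH⟩, rfl⟩)
      · exact ⟨Nat.pos_of_ne_zero fun h => hF (h ▸ h0), h0⟩
      · have : y + 1 ≠ F := fun h => hF (h ▸ hyH)
        exact ⟨by omega, hyH⟩
  rw [hA, Finset.card_insert_of_notMem (by simp),
    Finset.card_image_of_injective _ Nat.succ_injective]

/-- If `x₀` and `x₀ + 1` are gaps, the even numbers in `(x₀, F)` all lie in `H`, and `H` has no two
consecutive elements below `F`, then the least positive element `m` of `H` is at most `F - 1 - x₀`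
as soon as `m` is even and `H` has at least a third of the numbers below `F`. -/
lemma multiplicity_le_of_top_run (H : Set ℕ) {r j m : ℕ}
    (h0 : 0 ∈ H) (hadd : ∀ a ∈ H, ∀ b ∈ H, a + b ∈ H) (hF : 6 * r + 1 ∉ H)
    (hsep : ∀ a ∈ H, a + 1 < 6 * r + 1 → a + 1 ∉ H)
    [DecidablePred (· ∈ H)]
    (hcard : ((Finset.range (6 * r + 1)).filter (· ∈ H)).card = 2 * r + 1)
    (hj : 2 * j ≤ 6 * r) (hjH : 6 * r - 2 * j ∉ H) (htop : ∀ i < j, 6 * r - 2 * i ∈ H)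
    (hm : Even m) (hmF : m < 6 * r + 1) (hmin : ∀ n, 0 < n → n < m → n ∉ H) :
    m ≤ 2 * j := by
  set x₀ := 6 * r - 2 * j with hx₀
  have hodd : ∀ i < j, 6 * r - 2 * i - 1 ∉ H := by
    intro i hi h
    have := hsep _ h (by omega)
    rw [show 6 * r - 2 * i - 1 + 1 = 6 * r - 2 * i by omega] at this
    exact this (htop i hi)
  have hx₁ : x₀ + 1 ∉ H := by
    rcases j with _ | j
    · simpa [hx₀] using hF
    · have := hodd j (by omega)
      rwa [show x₀ + 1 = 6 * r - 2 * j - 1 by omega]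
  have hsucc := card_filter_range_eq_card_succ_add_one H h0 hF
  set A := (Finset.range (6 * r + 1)).filter (· ∈ H) with hA
  set A' := (Finset.range (6 * r + 1)).filter (fun x => x + 1 ∈ H) with hA'
  set P := (Finset.range (6 * r + 1)).filter (fun x => x ≤ x₀ ∧ x₀ - x ∈ H) with hP
  set X := (Finset.Icc 1 (m - 2)).filter (fun x => ¬ (x ≤ x₀ ∧ x₀ - x ∈ H)) with hX
  have hPcard : 2 * r + 1 ≤ P.card + j := by
    have hsub : A ⊆ P.image (fun x => x₀ - x) ∪
        (Finset.range j).image (fun i => 6 * r - 2 * i) := by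
      intro n hn
      simp only [hA, hP, Finset.mem_filter, Finset.mem_range, Finset.mem_union,
        Finset.mem_image] at hn ⊢
      by_cases h : n ≤ x₀
      · refine Or.inl ⟨x₀ - n, ⟨by omega, by omega, ?_⟩, by omega⟩
        rw [show x₀ - (x₀ - n) = n by omega]
        exact hn.2
      · refine Or.inr ⟨(6 * r - n) / 2, by omega, ?_⟩
        by_contra hne
        apply hodd ((6 * r - n) / 2) (by omega)
        rw [show 6 * r - 2 * ((6 * r - n) / 2) - 1 = n by omega]
        exact hn.2
    calc 2 * r + 1 = A.card := hcard.symm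
      _ ≤ _ := Finset.card_le_card hsub
      _ ≤ _ := Finset.card_union_le _ _
      _ ≤ P.card + (Finset.range j).card :=
        add_le_add Finset.card_image_le Finset.card_image_le
      _ = P.card + j := by rw [Finset.card_range]
  have hXcard : (m - 2) / 2 ≤ X.card := by
    have hsub : Finset.Icc 1 ((m - 2) / 2) ⊆ X.image (fun x => (x + 1) / 2) := by
      intro i hi
      rw [Finset.mem_Icc] at hi
      simp only [hX, Finset.mem_filter, Finset.mem_Icc, Finset.mem_image]
      by_cases h : 2 * i ≤ x₀ ∧ x₀ - 2 * i ∈ H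
      · refine ⟨2 * i - 1, ⟨by omega, fun h' => ?_⟩, by omega⟩
        apply hsep _ h.2 (by omega)
        rw [show x₀ - 2 * i + 1 = x₀ - (2 * i - 1) by omega]
        exact h'.2
      · exact ⟨2 * i, ⟨by omega, h⟩, by omega⟩
    calc (m - 2) / 2 = (Finset.Icc 1 ((m - 2) / 2)).card := by simp
      _ ≤ _ := Finset.card_le_card hsub
      _ ≤ _ := Finset.card_image_le
  have hAA' : Disjoint A A' := by
    rw [Finset.disjoint_left]
    intro x hx hx'
    simp only [hA, hA', Finset.mem_filter, Finset.mem_range] at hx hx'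
    have : x + 1 ≠ 6 * r + 1 := fun h => hF (h ▸ hx'.2)
    exact hsep x hx.2 (by omega) hx'.2
  have hAP : Disjoint (A ∪ A') P := by
    rw [Finset.disjoint_left]
    intro x hx hx'
    simp only [hA, hA', hP, Finset.mem_union, Finset.mem_filter, Finset.mem_range] at hx hx'
    rcases hx with hx | hx
    · apply hjH
      rw [show x₀ = x + (x₀ - x) by omega]
      exact hadd _ hx.2 _ hx'.2.2
    · apply hx₁
      rw [show x₀ + 1 = (x + 1) + (x₀ - x) by omega]
      exact hadd _ hx.2 _ hx'.2.2
  have hAX : Disjoint (A ∪ A' ∪ P) X := by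
    rw [Finset.disjoint_left]
    intro x hx hx'
    simp only [hA, hA', hP, hX, Finset.mem_union, Finset.mem_filter, Finset.mem_range,
      Finset.mem_Icc] at hx hx'
    rcases hx with (hx | hx) | hx
    · exact hmin x (by omega) (by omega) hx.2
    · exact hmin (x + 1) (by omega) (by omega) hx.2
    · exact hx'.2 hx.2
  have hsub : A ∪ A' ∪ P ∪ X ⊆ Finset.range (6 * r + 1) := by
    refine Finset.union_subset (Finset.union_subset (Finset.union_subset
      (Finset.filter_subset _ _) (Finset.filter_subset _ _)) (Finset.filter_subset _ _)) ?_
    intro x hx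
    simp only [hX, Finset.mem_filter, Finset.mem_Icc] at hx
    rw [Finset.mem_range]
    omega
  have hle := Finset.card_le_card hsub
  rw [Finset.card_union_of_disjoint hAX, Finset.card_union_of_disjoint hAP,
    Finset.card_union_of_disjoint hAA', Finset.card_range] at hle
  obtain ⟨q, rfl⟩ := hm
  omega

/-- If `H` has no two consecutive elements below its Frobenius number `6 * r + 1`, has `2 * r + 1`
elements below it, and the least positive element of `H` is even, then all these elements are
even. -/
lemma even_of_mem_of_lt_frobenius (H : Set ℕ) {r m : ℕ}
    (h0 : 0 ∈ H) (hadd : ∀ a ∈ H, ∀ b ∈ H, a + b ∈ H) (hF : 6 * r + 1 ∉ H)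
    (hsep : ∀ a ∈ H, a + 1 < 6 * r + 1 → a + 1 ∉ H)
    [DecidablePred (· ∈ H)]
    (hcard : ((Finset.range (6 * r + 1)).filter (· ∈ H)).card = 2 * r + 1)
    (hm : Even m) (hmH : m ∈ H) (hmpos : 0 < m) (hmin : ∀ n, 0 < n → n < m → n ∉ H)
    {n : ℕ} (hn : n ∈ H) (hnF : n < 6 * r + 1) : Even n := by
  by_contra hodd
  rw [Nat.not_even_iff_odd] at hodd
  have hmul : ∀ a ∈ H, ∀ t, n + t * a ∈ H := by
    intro a ha t
    induction t with
    | zero => simpa using hn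
    | succ t ih =>
      rw [Nat.succ_mul, ← add_assoc]
      exact hadd _ ih _ ha
  have h2 : 2 ∉ H := by
    intro h2
    apply hF
    obtain ⟨k, rfl⟩ := hodd
    have := hmul 2 h2 (3 * r - k)
    rwa [show 2 * k + 1 + (3 * r - k) * 2 = 6 * r + 1 by omega] at this
  have hmF : m < 6 * r + 1 := by
    by_contra hle
    obtain ⟨k, rfl⟩ := hodd
    exact hmin _ (by omega) (by omega) hn
  have hr : 1 ≤ r := by
    by_contra h
    omega
  have hex : ∃ j, 2 * j ≤ 6 * r ∧ 6 * r - 2 * j ∉ H :=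
    ⟨3 * r - 1, by omega, by rwa [show 6 * r - 2 * (3 * r - 1) = 2 by omega]⟩
  obtain ⟨hj, hjH⟩ := Nat.find_spec hex
  have htop : ∀ i < Nat.find hex, 6 * r - 2 * i ∈ H := by
    intro i hi
    by_contra h
    exact Nat.find_min hex hi ⟨by omega, h⟩
  have hle := multiplicity_le_of_top_run H h0 hadd hF hsep hcard hj hjH htop hm hmF hmin
  set t := (6 * r - n) / m with ht
  have hdiv := Nat.div_add_mod (6 * r - n) m
  have hmod := Nat.mod_lt (6 * r - n) hmpos
  rw [← ht, mul_comm] at hdiv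
  have ho : Odd (n + t * m) := hodd.add_even (hm.mul_left t)
  have hoH := hmul m hmH t
  have hoF : n + t * m ≤ 6 * r := by omega
  have hom : 6 * r < n + t * m + m := by omega
  generalize n + t * m = o at ho hoH hoF hom
  obtain ⟨k, rfl⟩ := ho
  apply hsep _ hoH (by omega)
  have := htop (3 * r - (k + 1)) (by omega)
  rwa [show 6 * r - 2 * (3 * r - (k + 1)) = 2 * k + 1 + 1 by omega] at this

lemma gap_notMem {H : Set ℕ} {g i : ℕ} (hH : IsNumericalSemigroupOfGenus H g)
    (hi : 1 ≤ i) (hig : i ≤ g) : gap H i ∉ H := by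
  obtain ⟨-, -, hfin, hcard⟩ := hH
  rw [Set.ncard_eq_toFinset_card _ hfin] at hcard
  exact Nat.nth_mem_of_lt_card (p := fun n => n ∉ H) hfin (lt_of_lt_of_eq (by omega) hcard.symm)

/-- Exactly `i - 1` gaps lie below the `i`-th gap. -/
lemma count_gap {H : Set ℕ} [DecidablePred (· ∉ H)] {g i : ℕ}
    (hH : IsNumericalSemigroupOfGenus H g) (hi : 1 ≤ i) (hig : i ≤ g) :
    Nat.count (· ∉ H) (gap H i) = i - 1 := by
  obtain ⟨-, -, hfin, hcard⟩ := hH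
  rw [Set.ncard_eq_toFinset_card _ hfin] at hcard
  exact Nat.count_nth_of_lt_card_finite (p := fun n => n ∉ H) hfin
    (lt_of_lt_of_eq (by omega) hcard.symm)

lemma le_gap_genus_of_notMem {H : Set ℕ} {g n : ℕ} (hH : IsNumericalSemigroupOfGenus H g)
    (hn : n ∉ H) : n ≤ gap H g := by
  obtain ⟨-, -, hfin, hcard⟩ := hH
  rw [Set.ncard_eq_toFinset_card _ hfin] at hcard
  obtain ⟨i, hi, rfl⟩ := Nat.exists_lt_card_finite_nth_eq (p := fun n => n ∉ H) hfin hn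
  have hi' : i < g := lt_of_lt_of_eq hi hcard
  exact Nat.nth_le_nth_of_lt_card hfin (by omega) (lt_of_lt_of_eq (by omega) hcard.symm)

/-- A sparse semigroup has no two consecutive elements below its Frobenius number. -/
lemma IsSparse.succ_notMem {H : Set ℕ} {g : ℕ} (hg : 1 ≤ g)
    (hH : IsNumericalSemigroupOfGenus H g)
    (hs : IsSparse H g) {a : ℕ} (ha : a ∈ H) (haF : a + 1 < gap H g) : a + 1 ∉ H := by
  classical
  intro ha1
  have h1 : 1 ∉ H := by
    intro h1
    have hall : ∀ n, n ∈ H := by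
      intro n
      induction n with
      | zero => exact hH.1
      | succ n ih => exact hH.2.1 _ ih _ h1
    exact gap_notMem hH hg le_rfl (hall _)
  have ha0 : 1 < a := by
    rcases a with _ | _ | a
    · exact absurd ha1 h1
    · exact absurd ha h1
    · omega
  set c := Nat.count (· ∉ H) a with hc
  have hc1 : 1 ≤ c := by
    have hle := Nat.count_monotone (· ∉ H) (show 1 + 1 ≤ a from ha0)
    rw [Nat.count_succ, if_pos h1] at hle
    omega
  have hcg : c ≤ g - 1 := by
    rw [← count_gap hH hg le_rfl]
    exact Nat.count_monotone _ (by omega)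
  have hlt : gap H c < a := Nat.nth_lt_of_lt_count (p := fun n => n ∉ H) (by omega)
  have hnext := gap_notMem hH (i := c + 1) (by omega) (by omega)
  have hge : a ≤ gap H (c + 1) := by
    by_contra! h
    have hle := Nat.count_monotone (· ∉ H) (Nat.succ_le_of_lt h)
    rw [Nat.succ_eq_add_one, Nat.count_succ, if_pos hnext,
      count_gap hH (by omega) (by omega)] at hle
    omega
  have hne : gap H (c + 1) ≠ a := fun h => hnext (h ▸ ha)
  have hne' : gap H (c + 1) ≠ a + 1 := fun h => hnext (h ▸ ha1)
  have := hs c hc1 hcg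
  omega

/-- If every element of `H` below `6 * r + 1` is even, there are `2 * r + 1` of them, and `H` contains
everything above `6 * r + 1`, then `H` has exactly `r` even gaps. -/
lemma ncard_even_gaps (H : Set ℕ) [DecidablePred (· ∈ H)] {r : ℕ}
    (hcard : ((Finset.range (6 * r + 1)).filter (· ∈ H)).card = 2 * r + 1)
    (hle : ∀ n, n ∉ H → n ≤ 6 * r + 1) (heven : ∀ n ∈ H, n < 6 * r + 1 → Even n) :
    {n : ℕ | n ∉ H ∧ Even n}.ncard = r := by
  set E := (Finset.range (3 * r + 1)).image (fun i => 2 * i) with hE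
  have hEcard : E.card = 3 * r + 1 := by
    rw [hE, Finset.card_image_of_injective _ (fun a b h => by simpa using h), Finset.card_range]
  have hset : {n : ℕ | n ∉ H ∧ Even n} = ↑(E.filter (· ∉ H)) := by
    ext n
    simp only [hE, Set.mem_ofPred_eq, Finset.coe_filter, Finset.mem_image, Finset.mem_range]
    constructor
    · rintro ⟨hn, k, rfl⟩
      have := hle _ hn
      exact ⟨⟨k, by omega, by omega⟩, hn⟩
    · rintro ⟨⟨k, -, rfl⟩, hn⟩
      exact ⟨hn, even_two_mul k⟩
  have hA : (Finset.range (6 * r + 1)).filter (· ∈ H) = E.filter (· ∈ H) := by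
    ext n
    simp only [hE, Finset.mem_filter, Finset.mem_image, Finset.mem_range]
    constructor
    · rintro ⟨hn, hnH⟩
      obtain ⟨k, rfl⟩ := heven n hnH hn
      exact ⟨⟨k, by omega, by omega⟩, hnH⟩
    · rintro ⟨⟨k, hk, rfl⟩, hnH⟩
      exact ⟨by omega, hnH⟩
  rw [hset, Set.ncard_coe_finset]
  have := Finset.card_filter_add_card_filter_not (s := E) (· ∈ H)
  rw [← hA] at this
  omega

/-- **Theorem.** Let `H` be a limit sparse numerical semigroup with odd Frobenius
number `ℓ_g = 2g - (2r+1) = 6r + 1`. If the multOf of `H` is even, then every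
element of `H` smaller than `ℓ_g` is even, and so `H` is `r`-hyperelliptic
(has exactly `r` even gaps). -/
theorem odd_frobenius_even_multiplicity (H : Set ℕ) (g r : ℕ) (hg : 1 < g)
    (hH : IsNumericalSemigroupOfGenus H g) (hs : IsSparse H g)
    (hlim : numSingle H g = numDouble H g)
    (hF : gap H g = 2 * g - (2 * r + 1)) (hF' : gap H g = 6 * r + 1)
    (hmult : Even (multOf H)) :
    (∀ n ∈ H, n < gap H g → Even n) ∧ {n : ℕ | n ∉ H ∧ Even n}.ncard = r := by
  classical
  obtain rfl : g = 4 * r + 1 := by omega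
  have hgap := gap_notMem hH (i := 4 * r + 1) (by omega) le_rfl
  have hcount := count_gap hH (i := 4 * r + 1) (by omega) le_rfl
  have hle : ∀ n, n ∉ H → n ≤ gap H (4 * r + 1) := fun n hn => le_gap_genus_of_notMem hH hn
  have hsep : ∀ a ∈ H, a + 1 < gap H (4 * r + 1) → a + 1 ∉ H :=
    fun a ha haF => hs.succ_notMem (by omega) hH ha haF
  rw [hF'] at hgap hcount hle hsep ⊢
  have hcard : ((Finset.range (6 * r + 1)).filter (· ∈ H)).card = 2 * r + 1 := by
    have := Finset.card_filter_add_card_filter_not (s := Finset.range (6 * r + 1)) (· ∈ H)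
    rw [Nat.count_eq_card_filter_range] at hcount
    rw [Finset.card_range] at this
    omega
  have heven : ∀ n ∈ H, n < 6 * r + 1 → Even n := by
    intro n hn hnF
    have hne : {n : ℕ | n ∈ H ∧ 0 < n}.Nonempty :=
      ⟨6 * r + 2, by_contra fun h => by
        have := hle (6 * r + 2) (fun h' => h ⟨h', by omega⟩)
        omega⟩
    obtain ⟨hmH, hmpos⟩ := Nat.sInf_mem hne
    exact even_of_mem_of_lt_frobenius H hH.1 hH.2.1 hgap hsep hcard hmult hmH hmpos
      (fun k hk hkm hkH => Nat.notMem_of_lt_sInf hkm ⟨hkH, hk⟩) hn hnF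
  exact ⟨heven, ncard_even_gaps H hcard hle heven⟩
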